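/- Let N be a commutative (not necessarily associative) algebra over a field K of characteristic ≠ 2, 3 satisfying the identity x³ = 0 for all x ∈ N (where x³ = x²·x). If N satisfies the descending chain condition on ideals, then N is finite-dimensional over K. -/

import Mathlib

namespace MockLie

/-- The four variables of the degree eight identity. -/
inductive Letter | x | y | z | w

/-- Formal iterated Jordan products of letters. -/
inductive JordanExpr
  | var (i : Letter)
  | mul (a b : JordanExpr)

/-- Products of the noncommutative polynomials given as lists of monomials. -/
def wordsMul (A B : List (List Letter)) : List (List Letter) :=
  A.flatMap fun u => B.map fun v => u ++ v

namespace JordanExpr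

/-- The expansion with respect to the product `a * b + b * a`. -/
def words : JordanExpr → List (List Letter)
  | var i => [[i]]
  | mul a b => wordsMul a.words b.words ++ wordsMul b.words a.words

def rename (σ : Letter → Letter) : JordanExpr → JordanExpr
  | var i => var (σ i)
  | mul a b => mul (a.rename σ) (b.rename σ)

end JordanExpr

/-- An instance, multiplied by `coeff`, of the relation saying that the sum of the products of
`P`, `Q`, `R` in all orders vanishes, placed between the words `left` and `right`. -/
structure RelationInstance where
  coeff : ℤ
  left : List Letter
  P : JordanExpr
  Q : JordanExpr
  R : JordanExpr
  right : List Letter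

namespace RelationInstance

def words (e : RelationInstance) : List (List Letter) :=
  let p := e.P.words
  let q := e.Q.words
  let r := e.R.words
  wordsMul [e.left] (wordsMul
    (wordsMul p (wordsMul q r ++ wordsMul r q) ++ (wordsMul q (wordsMul p r ++ wordsMul r p) ++
      wordsMul r (wordsMul p q ++ wordsMul q p))) [e.right])

def rename (σ : Letter → Letter) (e : RelationInstance) : RelationInstance :=
  ⟨e.coeff, e.left.map σ, e.P.rename σ, e.Q.rename σ, e.R.rename σ, e.right.map σ⟩

def reverse (e : RelationInstance) : RelationInstance :=
  { e with left := e.right.reverse, right := e.left.reverse }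

end RelationInstance

/-- Finitely supported integer valued functions on words, stored as prefix trees. -/
inductive WordTrie
  | nil
  | node (n : ℤ) (a b c d : WordTrie)

namespace WordTrie

def insert (n : ℤ) : List Letter → WordTrie → WordTrie
  | [], nil => node n nil nil nil nil
  | [], node m a b c d => node (m + n) a b c d
  | .x :: u, nil => node 0 (insert n u nil) nil nil nil
  | .y :: u, nil => node 0 nil (insert n u nil) nil nil
  | .z :: u, nil => node 0 nil nil (insert n u nil) nil
  | .w :: u, nil => node 0 nil nil nil (insert n u nil)
  | .x :: u, node m a b c d => node m (insert n u a) b c d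
  | .y :: u, node m a b c d => node m a (insert n u b) c d
  | .z :: u, node m a b c d => node m a b (insert n u c) d
  | .w :: u, node m a b c d => node m a b c (insert n u d)

def insertAll (n : ℤ) (l : List (List Letter)) (t : WordTrie) : WordTrie :=
  l.foldr (insert n) t

def add : WordTrie → WordTrie → WordTrie
  | nil, t => t
  | s, nil => s
  | node m a b c d, node n a' b' c' d' =>
    node (m + n) (a.add a') (b.add b') (c.add c') (d.add d')

def sum (l : List WordTrie) : WordTrie :=
  l.foldr add nil

def isZero : WordTrie → Bool
  | nil => true
  | node n a b c d => n == 0 && a.isZero && b.isZero && c.isZero && d.isZero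

end WordTrie

def RelationInstance.trie (e : RelationInstance) : WordTrie :=
  WordTrie.nil.insertAll e.coeff e.words

section Evaluation

variable {A : Type*} [Ring A] (g : Letter → A)

def evalWord (u : List Letter) : A := (u.map g).prod

def evalWords (l : List (List Letter)) : A := (l.map (evalWord g)).sum

theorem evalWord_append (u v : List Letter) :
    evalWord g (u ++ v) = evalWord g u * evalWord g v := by
  simp [evalWord]

theorem evalWords_append (l m : List (List Letter)) :
    evalWords g (l ++ m) = evalWords g l + evalWords g m := by
  simp [evalWords]

theorem evalWords_wordsMul (l m : List (List Letter)) :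
    evalWords g (wordsMul l m) = evalWords g l * evalWords g m := by
  have key (u : List Letter) :
      evalWords g (m.map fun v => u ++ v) = evalWord g u * evalWords g m := by
    simp only [evalWords, List.map_map, ← List.sum_map_mul_left]
    congr 1
    exact List.map_congr_left fun v _ => evalWord_append g u v
  induction l with
  | nil => simp [wordsMul, evalWords]
  | cons u l ih =>
    rw [wordsMul, List.flatMap_cons, evalWords_append, key]
    change _ + evalWords g (wordsMul l m) = _
    rw [ih, ← add_mul]
    simp [evalWords]

def WordTrie.eval : WordTrie → A
  | .nil => 0
  | .node n a b c d => n + g .x * a.eval + g .y * b.eval + g .z * c.eval + g .w * d.eval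

theorem WordTrie.eval_insert (n : ℤ) (u : List Letter) (t : WordTrie) :
    (t.insert n u).eval g = n * evalWord g u + t.eval g := by
  have comm (h e : A) : (n : A) * (h * e) = h * (n * e) := (Int.cast_commute n h).left_comm e
  induction u generalizing t with
  | nil => cases t <;> simp [WordTrie.insert, WordTrie.eval, evalWord]; abel
  | cons i u ih =>
    have hi : evalWord g (i :: u) = g i * evalWord g u := by simp [evalWord]
    cases t with
    | nil => cases i <;> simp [WordTrie.insert, WordTrie.eval, ih, hi, comm]
    | node => cases i <;> simp only [WordTrie.insert, WordTrie.eval, ih, hi, comm, mul_add] <;> abel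

theorem WordTrie.eval_insertAll (n : ℤ) (l : List (List Letter)) (t : WordTrie) :
    (t.insertAll n l).eval g = n * evalWords g l + t.eval g := by
  induction l with
  | nil => simp [WordTrie.insertAll, evalWords]
  | cons u l ih =>
    rw [WordTrie.insertAll, List.foldr_cons, WordTrie.eval_insert]
    change _ + (t.insertAll n l).eval g = _
    rw [ih]
    simp [evalWords, mul_add, add_assoc]

theorem WordTrie.eval_add (s t : WordTrie) : (s.add t).eval g = s.eval g + t.eval g := by
  induction s generalizing t with
  | nil => simp [WordTrie.add, WordTrie.eval]
  | node m a b c d ha hb hc hd =>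
    cases t with
    | nil => simp [WordTrie.add, WordTrie.eval]
    | node =>
      simp only [WordTrie.add, WordTrie.eval, ha, hb, hc, hd, mul_add, Int.cast_add]
      abel

theorem WordTrie.eval_sum_eq_zero {l : List WordTrie} (h : ∀ t ∈ l, t.eval g = 0) :
    (WordTrie.sum l).eval g = 0 := by
  induction l with
  | nil => rfl
  | cons t l ih =>
    rw [WordTrie.sum, List.foldr_cons, WordTrie.eval_add, h t List.mem_cons_self, zero_add]
    exact ih fun s hs => h s (List.mem_cons_of_mem _ hs)

theorem WordTrie.eval_eq_zero {t : WordTrie} (h : t.isZero = true) : t.eval g = 0 := by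
  induction t with
  | nil => rfl
  | node n a b c d ha hb hc hd =>
    simp only [WordTrie.isZero, Bool.and_eq_true, beq_iff_eq] at h
    simp [WordTrie.eval, ha h.1.1.1.2, hb h.1.1.2, hc h.1.2, hd h.2, h.1.1.1.1]

theorem JordanExpr.evalWords_mem {L : Set A}
    (hL : ∀ a ∈ L, ∀ b ∈ L, a * b + b * a ∈ L) (hg : ∀ i, g i ∈ L)
    (P : JordanExpr) : evalWords g P.words ∈ L := by
  induction P with
  | var i => simpa [JordanExpr.words, evalWords, evalWord] using hg i
  | mul a b ha hb =>
    rw [JordanExpr.words, evalWords_append, evalWords_wordsMul, evalWords_wordsMul]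
    exact hL _ ha _ hb


theorem RelationInstance.eval_trie_eq_zero {L : Set A}
    (hL : ∀ a ∈ L, ∀ b ∈ L, a * b + b * a ∈ L)
    (hrel : ∀ a ∈ L, ∀ b ∈ L, ∀ c ∈ L,
      a * (b * c + c * b) + (b * (a * c + c * a) + c * (a * b + b * a)) = 0)
    (hg : ∀ i, g i ∈ L) (e : RelationInstance) : e.trie.eval g = 0 := by
  have h := hrel _ (e.P.evalWords_mem g hL hg) _ (e.Q.evalWords_mem g hL hg) _
    (e.R.evalWords_mem g hL hg)
  simp only [RelationInstance.trie, WordTrie.eval_insertAll, RelationInstance.words,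
    evalWords_wordsMul, evalWords_append, h, zero_mul, mul_zero, WordTrie.eval, add_zero]

end Evaluation

/-- The symmetries of the target expression `(x² ∘ y²) ∘ (z² ∘ w²)`. -/
def symmetries : List (Letter → Letter) :=
  let perm (a b c d : Letter) : Letter → Letter := fun
    | .x => a
    | .y => b
    | .z => c
    | .w => d
  [perm .x .y .z .w, perm .y .x .z .w, perm .x .y .w .z, perm .y .x .w .z,
    perm .z .w .x .y, perm .w .z .x .y, perm .z .w .y .x, perm .w .z .y .x]

instance : Mul JordanExpr := ⟨.mul⟩

/-- Relations whose symmetrization is a multiple of the expression `(x² ∘ y²) ∘ (z² ∘ w²)`. -/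
def certificate : List RelationInstance :=
  let x : JordanExpr := .var .x
  let y : JordanExpr := .var .y
  let z : JordanExpr := .var .z
  let w : JordanExpr := .var .w
  [
  ⟨42, [.w, .w], x, x, y * y, [.z, .z]⟩,
  ⟨48, [.w, .y, .y, .w, .z], x, x, z, []⟩,
  ⟨12, [.w, .y, .y, .w], x, x, z, [.z]⟩,
  ⟨-60, [], x, z * z, x * (w * w), [.y, .y]⟩,
  ⟨48, [], x, x, y * y, [.w, .w, .z, .z]⟩,
  ⟨60, [.w, .y, .y, .z, .w], x, x, z, []⟩,
  ⟨-12, [], x, x, z, [.w, .z, .y, .w, .y]⟩,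
  ⟨-21, [.w], x * x, y * y, z * z, [.w]⟩,
  ⟨-24, [.w], x, x, y, [.w, .y, .z, .z]⟩,
  ⟨24, [.w, .w, .y, .z, .y], x, x, z, []⟩,
  ⟨-24, [.w, .x, .w, .z], x, z, y * y, []⟩,
  ⟨24, [], x, x, z, [.y, .w, .w, .z, .y]⟩,
  ⟨-16, [.w, .w], x, z, x * z, [.y, .y]⟩,
  ⟨-120, [], x, x, z, [.w, .w, .y, .y, .z]⟩,
  ⟨24, [.w, .w, .z, .x], x, z, y * y, []⟩,
  ⟨-24, [.w, .w, .z], x, x, y, [.y, .z]⟩,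
  ⟨-48, [.w], x, y * y, z * w, [.z, .x]⟩,
  ⟨72, [.w, .w, .z, .y, .y], x, x, z, []⟩,
  ⟨-12, [], x, z * z, w * w, [.y, .x, .y]⟩,
  ⟨24, [.y, .y], x, x, z, [.w, .w, .z]⟩,
  ⟨-48, [.w, .z, .z, .w], x, x, y, [.y]⟩,
  ⟨-114, [.w, .w, .y, .y], x, x, z * z, []⟩,
  ⟨220, [.w, .w], x, x, z * z, [.y, .y]⟩,
  ⟨-12, [], x, x, z, [.w, .w, .z, .y, .y]⟩,
  ⟨24, [.w], x, x, z, [.w, .y, .z, .y]⟩,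
  ⟨48, [.x, .w, .w, .y], x, y, z, [.z]⟩,
  ⟨-84, [.w, .w], x, x, y, [.z, .z, .y]⟩,
  ⟨-12, [.w], x, x, y, [.w, .z, .y, .z]⟩,
  ⟨12, [.w, .y], x, x, z, [.w, .y, .z]⟩,
  ⟨-120, [], x, x, z, [.y, .y, .w, .w, .z]⟩,
  ⟨24, [.w], x, x, z * z, [.y, .w, .y]⟩,
  ⟨-24, [.y, .w, .w, .y, .z], x, x, z, []⟩,
  ⟨24, [.w], x, x, y, [.w, .z, .z, .y]⟩,
  ⟨192, [], x, x, y, [.w, .w, .z, .z, .y]⟩,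
  ⟨168, [], x, y * y, z * z, [.w, .w, .x]⟩,
  ⟨-24, [.w, .y, .z, .w], x, x, y, [.z]⟩,
  ⟨-12, [.y, .w], x, x, z * w, [.z, .y]⟩,
  ⟨24, [.w], x, x, z, [.y, .w, .z, .y]⟩,
  ⟨24, [.w, .x, .w, .y], x, y, z, [.z]⟩,
  ⟨48, [.w, .x, .z], x, y, z, [.w, .y]⟩,
  ⟨-24, [.w], x, x, y, [.y, .z, .z, .w]⟩,
  ⟨24, [.w, .y], x, x, z, [.w, .z, .y]⟩,
  ⟨48, [.w, .x], x, y, z, [.z, .y, .w]⟩,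
  ⟨24, [.x, .w], x, y, z, [.z, .w, .y]⟩,
  ⟨-24, [.x, .w], x, y, z, [.w, .z, .y]⟩,
  ⟨24, [.w, .x], x, z, y * w, [.y, .z]⟩,
  ⟨-48, [.w, .y, .z, .z], x, x, y, [.w]⟩,
  ⟨24, [], x, z, y * y, [.w, .z, .w, .x]⟩,
  ⟨12, [.w, .x], x, y, z * z, [.y, .w]⟩,
  ⟨48, [.x], x, y, z, [.w, .w, .y, .z]⟩,
  ⟨-48, [], x, x, y, [.w, .y, .z, .z, .w]⟩,
  ⟨-18, [.w], x * x, y * y, z * w, [.z]⟩,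
  ⟨12, [.w], x, y * y, z * z, [.x, .w]⟩,
  ⟨24, [.w, .x], x, y, z * w, [.y, .z]⟩,
  ⟨24, [.y], x * x, y * z, w * w, [.z]⟩,
  ⟨48, [.w, .z, .w], x, z, y * y, [.x]⟩,
  ⟨-24, [], x * z, x * w, y * z, [.w, .y]⟩,
  ⟨90, [], x, x, z * z, [.w, .w, .y, .y]⟩,
  ⟨-9, [], x * x, y * y, z * (w * w), [.z]⟩,
  ⟨-9, [], x * x, y * (z * z), y * (w * w), []⟩,
  ⟨-24, [.y], x, y * z, w * w, [.x, .z]⟩]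

def targetExpr : JordanExpr :=
  let sq (i : Letter) : JordanExpr := .var i * .var i
  (sq .x * sq .y) * (sq .z * sq .w)

def combination : WordTrie :=
  (WordTrie.nil.insertAll (-108) targetExpr.words).add <|
    WordTrie.sum <| symmetries.map fun σ => WordTrie.sum <| certificate.map fun e =>
      (e.rename σ).trie.add (e.rename σ).reverse.trie

theorem combination_isZero : combination.isZero = true := by
  decide +kernel

theorem jordanMul_jordanMul_sq_eq_zero {A : Type*} [Ring A] {L : Set A}
    (hL : ∀ a ∈ L, ∀ b ∈ L, a * b + b * a ∈ L)
    (hrel : ∀ a ∈ L, ∀ b ∈ L, ∀ c ∈ L,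
      a * (b * c + c * b) + (b * (a * c + c * a) + c * (a * b + b * a)) = 0)
    (g : Letter → A) (hg : ∀ i, g i ∈ L) : 108 * evalWords g targetExpr.words = 0 := by
  have h := WordTrie.eval_eq_zero g combination_isZero
  rw [combination, WordTrie.eval_add, WordTrie.eval_insertAll, WordTrie.eval_sum_eq_zero] at h
  · simpa [WordTrie.eval] using h
  · simp only [List.mem_map]
    rintro _ ⟨σ, _, rfl⟩
    refine WordTrie.eval_sum_eq_zero g ?_
    simp only [List.mem_map]
    rintro _ ⟨e, _, rfl⟩
    rw [WordTrie.eval_add, RelationInstance.eval_trie_eq_zero g hL hrel hg,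
      RelationInstance.eval_trie_eq_zero g hL hrel hg, add_zero]

section Algebra

theorem eq_zero_of_two_nsmul {K M : Type*} [Field K] [AddCommGroup M] [Module K M]
    (h2 : (2 : K) ≠ 0) {a : M} (h : (2 : ℕ) • a = 0) : a = 0 := by
  have h' : (2 : K) • a = 0 := by rwa [← Nat.cast_smul_eq_nsmul K] at h
  exact (smul_eq_zero.mp h').resolve_left h2

variable {K N : Type*} [Field K] [NonUnitalNonAssocCommRing N] [Module K N]

theorem jacobi_of_cube_eq_zero (h2 : (2 : K) ≠ 0) (hcube : ∀ x : N, (x * x) * x = 0) (a b c : N) :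
    (a * b) * c + (b * c) * a + (c * a) * b = 0 := by
  have key : (2 : ℕ) • ((a * b) * c + (b * c) * a + (c * a) * b) =
      ((a + b + c) * (a + b + c)) * (a + b + c) - ((a + b) * (a + b)) * (a + b) -
        ((b + c) * (b + c)) * (b + c) - ((a + c) * (a + c)) * (a + c) + (a * a) * a +
        (b * b) * b + (c * c) * c := by
    simp only [mul_add, add_mul, mul_comm b a, mul_comm c a, mul_comm c b]
    abel
  exact eq_zero_of_two_nsmul h2 (key.trans (by simp [hcube]))

variable [SMulCommClass K N N]

open LinearMap (mulLeft)

theorem jordanMul_mulLeft (hjac : ∀ a b c : N, (a * b) * c + (b * c) * a + (c * a) * b = 0)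
    (a b : N) : mulLeft K a * mulLeft K b + mulLeft K b * mulLeft K a = -mulLeft K (a * b) := by
  ext n
  have h := hjac a b n
  simp only [LinearMap.add_apply, Module.End.mul_apply, LinearMap.mulLeft_apply,
    LinearMap.neg_apply]
  rw [mul_comm (b * n), mul_comm (n * a), mul_comm n a] at h
  rw [eq_neg_iff_add_eq_zero, ← h]
  abel

theorem sum_perms_mulLeft (h2 : (2 : K) ≠ 0)
    (hjac : ∀ a b c : N, (a * b) * c + (b * c) * a + (c * a) * b = 0) (a b c : N) :
    mulLeft K a * (mulLeft K b * mulLeft K c + mulLeft K c * mulLeft K b) +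
      (mulLeft K b * (mulLeft K a * mulLeft K c + mulLeft K c * mulLeft K a) +
        mulLeft K c * (mulLeft K a * mulLeft K b + mulLeft K b * mulLeft K a)) = 0 := by
  have key (u v w : N) :
      (mulLeft K u * mulLeft K v + mulLeft K v * mulLeft K u) * mulLeft K w +
        mulLeft K w * (mulLeft K u * mulLeft K v + mulLeft K v * mulLeft K u) =
      mulLeft K (u * v * w) := by
    rw [jordanMul_mulLeft hjac, neg_mul, mul_neg, ← neg_add, jordanMul_mulLeft hjac, neg_neg]
  have h : mulLeft K (a * b * c) + mulLeft K (b * c * a) + mulLeft K (c * a * b) = 0 := by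
    ext n
    simp [← add_mul, hjac]
  rw [← key, ← key, ← key] at h
  refine eq_zero_of_two_nsmul h2 ?_
  rw [two_nsmul, ← h]
  noncomm_ring

theorem sq_mul_sq_mul_sq_mul_sq_mul_eq_zero (h2 : (2 : K) ≠ 0) (h3 : (3 : K) ≠ 0)
    (hjac : ∀ a b c : N, (a * b) * c + (b * c) * a + (c * a) * b = 0) (a b c d n : N) :
    (((a * a) * (b * b)) * ((c * c) * (d * d))) * n = 0 := by
  let g : Letter → Module.End K N := fun
    | .x => mulLeft K a
    | .y => mulLeft K b
    | .z => mulLeft K c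
    | .w => mulLeft K d
  let L : Set (Module.End K N) := Set.range fun u : N => mulLeft K u
  have hL : ∀ p ∈ L, ∀ q ∈ L, p * q + q * p ∈ L := by
    rintro _ ⟨u, rfl⟩ _ ⟨v, rfl⟩
    exact ⟨-(u * v), by ext; simp [jordanMul_mulLeft hjac]⟩
  have hrel : ∀ p ∈ L, ∀ q ∈ L, ∀ r ∈ L,
      p * (q * r + r * q) + (q * (p * r + r * p) + r * (p * q + q * p)) = 0 := by
    rintro _ ⟨u, rfl⟩ _ ⟨v, rfl⟩ _ ⟨w, rfl⟩
    exact sum_perms_mulLeft h2 hjac u v w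
  have hg : ∀ i, g i ∈ L := by
    rintro (_ | _ | _ | _)
    exacts [⟨a, rfl⟩, ⟨b, rfl⟩, ⟨c, rfl⟩, ⟨d, rfl⟩]
  have hmul (P Q : JordanExpr) (u v : N) (hP : evalWords g P.words = -mulLeft K u)
      (hQ : evalWords g Q.words = -mulLeft K v) :
      evalWords g (P * Q).words = -mulLeft K (u * v) := by
    change evalWords g (JordanExpr.mul P Q).words = _
    rw [JordanExpr.words, evalWords_append, evalWords_wordsMul, evalWords_wordsMul, hP, hQ,
      neg_mul_neg, neg_mul_neg, jordanMul_mulLeft hjac]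
  have hsq (i : Letter) (u : N) (hi : g i = mulLeft K u) :
      evalWords g (JordanExpr.var i * JordanExpr.var i).words = -mulLeft K (u * u) := by
    change evalWords g (JordanExpr.mul _ _).words = _
    rw [JordanExpr.words, evalWords_append, evalWords_wordsMul, ← jordanMul_mulLeft hjac, ← hi]
    simp [JordanExpr.words, evalWords, evalWord]
  have htarget : evalWords g targetExpr.words =
      -mulLeft K (((a * a) * (b * b)) * ((c * c) * (d * d))) :=
    hmul _ _ _ _ (hmul _ _ _ _ (hsq .x a rfl) (hsq .y b rfl))
      (hmul _ _ _ _ (hsq .z c rfl) (hsq .w d rfl))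
  have h := jordanMul_jordanMul_sq_eq_zero hL hrel g hg
  rw [htarget] at h
  have h108 : (108 : K) ≠ 0 := by
    rw [show (108 : K) = 2 ^ 2 * 3 ^ 3 by norm_num]
    exact mul_ne_zero (pow_ne_zero _ h2) (pow_ne_zero _ h3)
  have hs : (108 : K) • mulLeft K (((a * a) * (b * b)) * ((c * c) * (d * d))) = 0 := by
    rw [← neg_eq_zero, ← smul_neg, ← h, Algebra.smul_def, map_ofNat]
  simpa using LinearMap.congr_fun ((smul_eq_zero.mp hs).resolve_left h108) n

variable [IsScalarTower K N N]

/-- The span of all products of an element of `I` and an element of `J`. -/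
abbrev spanMul (I J : Submodule K N) : Submodule K N := Submodule.map₂ (LinearMap.mul K N) I J

theorem mul_mem_spanMul {I J : Submodule K N} {a b : N} (ha : a ∈ I) (hb : b ∈ J) :
    a * b ∈ spanMul I J :=
  Submodule.apply_mem_map₂ (LinearMap.mul K N) ha hb

theorem spanMul_le {I J M : Submodule K N} : spanMul I J ≤ M ↔ ∀ a ∈ I, ∀ b ∈ J, a * b ∈ M :=
  Submodule.map₂_le

theorem spanMul_top_top (h2 : (2 : K) ≠ 0) :
    spanMul (⊤ : Submodule K N) ⊤ = Submodule.span K (Set.range fun a : N => a * a) := by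
  have hmem (a : N) : a * a ∈ Submodule.span K (Set.range fun a : N => a * a) :=
    Submodule.subset_span ⟨a, rfl⟩
  refine le_antisymm (spanMul_le.mpr fun a _ b _ => ?_) (Submodule.span_le.mpr ?_)
  · have h : (2 : K) • (a * b) = (a + b) * (a + b) - a * a - b * b := by
      rw [two_smul, mul_add, add_mul, add_mul, mul_comm b a]
      abel
    rw [← Submodule.smul_mem_iff _ h2, h]
    exact sub_mem (sub_mem (hmem _) (hmem _)) (hmem _)
  · rintro _ ⟨a, rfl⟩
    exact mul_mem_spanMul trivial trivial

/-- The derived series of `N`, starting with `N` itself. -/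
def derived (K N : Type*) [Field K] [NonUnitalNonAssocCommRing N] [Module K N]
    [SMulCommClass K N N] [IsScalarTower K N N] : ℕ → Submodule K N
  | 0 => ⊤
  | k + 1 => spanMul (derived K N k) (derived K N k)

theorem derived_three_mul_eq_zero (h2 : (2 : K) ≠ 0) (h3 : (3 : K) ≠ 0)
    (hjac : ∀ a b c : N, (a * b) * c + (b * c) * a + (c * a) * b = 0) {u : N}
    (hu : u ∈ derived K N 3) (n : N) : u * n = 0 := by
  have h : derived K N 3 ≤ LinearMap.ker (LinearMap.mulRight K n) := by
    simp only [derived]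
    rw [spanMul_top_top h2, spanMul, spanMul, Submodule.map₂_span_span, Submodule.map₂_span_span,
      Submodule.span_le]
    rintro _ ⟨_, ⟨_, ⟨a, rfl⟩, _, ⟨b, rfl⟩, rfl⟩, _, ⟨_, ⟨c, rfl⟩, _, ⟨d, rfl⟩, rfl⟩, rfl⟩
    exact sq_mul_sq_mul_sq_mul_sq_mul_eq_zero h2 h3 hjac a b c d n
  exact h hu

def IsIdeal (I : Submodule K N) : Prop := ∀ a : N, ∀ x ∈ I, a * x ∈ I

theorem IsIdeal.spanMul (hjac : ∀ a b c : N, (a * b) * c + (b * c) * a + (c * a) * b = 0)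
    {I J : Submodule K N} (hI : IsIdeal I) (hJ : IsIdeal J) : IsIdeal (spanMul I J) := by
  intro n x hx
  have h : MockLie.spanMul I J ≤ (MockLie.spanMul I J).comap (LinearMap.mulLeft K n) := by
    refine spanMul_le.mpr fun a ha b hb => ?_
    have e : n * (a * b) = -((n * a) * b) - a * (n * b) := by
      have h := hjac n a b
      rw [mul_comm (a * b), mul_comm (b * n), mul_comm b n] at h
      rw [← sub_eq_zero, ← h]
      abel
    rw [Submodule.mem_comap, LinearMap.mulLeft_apply, e]
    exact sub_mem (neg_mem (mul_mem_spanMul (hI n a ha) hb)) (mul_mem_spanMul ha (hJ n b hb))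
  exact h hx

theorem derived_isIdeal (hjac : ∀ a b c : N, (a * b) * c + (b * c) * a + (c * a) * b = 0) (k : ℕ) :
    IsIdeal (derived K N k) := by
  induction k with
  | zero => exact fun _ _ _ => trivial
  | succ k ih => exact ih.spanMul hjac ih

/-- The lower central series of `N`, starting with `N` itself. -/
def lowerSeries (K N : Type*) [Field K] [NonUnitalNonAssocCommRing N] [Module K N]
    [SMulCommClass K N N] [IsScalarTower K N N] : ℕ → Submodule K N
  | 0 => ⊤
  | k + 1 => spanMul ⊤ (lowerSeries K N k)

theorem lowerSeries_succ_le (k : ℕ) : lowerSeries K N (k + 1) ≤ lowerSeries K N k := by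
  induction k with
  | zero => exact le_top
  | succ k ih => exact Submodule.map₂_le_map₂_right ih

theorem exists_fg_sup_lowerSeries_succ
    (hjac : ∀ a b c : N, (a * b) * c + (b * c) * a + (c * a) * b = 0) {F : Submodule K N}
    (hF : F.FG) (hFtop : F ⊔ spanMul ⊤ ⊤ = ⊤) (k : ℕ) :
    ∃ G : Submodule K N, G.FG ∧ lowerSeries K N k = G ⊔ lowerSeries K N (k + 1) := by
  induction k with
  | zero => exact ⟨F, hF, hFtop.symm⟩
  | succ k ih =>
    obtain ⟨G, hG, hk⟩ := ih
    have hGk : G ≤ lowerSeries K N k := hk ▸ le_sup_left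
    refine ⟨spanMul F G, hF.map₂ _ hG, le_antisymm ?_ (sup_le ?_ (lowerSeries_succ_le _))⟩
    · change spanMul ⊤ (lowerSeries K N k) ≤ _
      rw [hk, spanMul, Submodule.map₂_sup_right]
      refine sup_le ?_ le_sup_right
      rw [← hFtop, Submodule.map₂_sup_left]
      refine sup_le_sup_left ?_ _
      refine Submodule.map₂_le.mpr fun m hm x hx => ?_
      have hx := hGk hx
      have h : spanMul ⊤ ⊤ ≤
          (lowerSeries K N (k + 2)).comap (LinearMap.mulRight K x) := by
        refine spanMul_le.mpr fun a _ b _ => ?_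
        have e : a * b * x = -(a * (b * x)) - b * (a * x) := by
          have h := hjac a b x
          rw [mul_comm (b * x), mul_comm (x * a), mul_comm x a] at h
          rw [← sub_eq_zero, ← h]
          abel
        rw [Submodule.mem_comap, LinearMap.mulRight_apply, e]
        exact sub_mem (neg_mem (mul_mem_spanMul trivial (mul_mem_spanMul trivial hx)))
          (mul_mem_spanMul trivial (mul_mem_spanMul trivial hx))
      exact h hm
    · exact Submodule.map₂_le_map₂ le_top hGk

/-- Some iterated product `C * (C * (⋯ * (C * I)))` is contained in `J`. -/
def NilpotentOn (I J C : Submodule K N) : Prop := ∃ r : ℕ, (spanMul C)^[r] I ≤ J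

theorem monotone_iterate_spanMul (C : Submodule K N) (r : ℕ) : Monotone (spanMul C)^[r] :=
  Monotone.iterate (fun _ _ h => Submodule.map₂_le_map₂_right h) r

theorem isIdeal_iterate_spanMul
    (hjac : ∀ a b c : N, (a * b) * c + (b * c) * a + (c * a) * b = 0) {I C : Submodule K N}
    (hI : IsIdeal I) (hC : IsIdeal C) (r : ℕ) : IsIdeal ((spanMul C)^[r] I) := by
  induction r with
  | zero => exact hI
  | succ r ih =>
    rw [Function.iterate_succ_apply']
    exact hC.spanMul hjac ih

theorem spanMul_spanMul_sup_span_singleton_le (h2 : (2 : K) ≠ 0)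
    (hjac : ∀ a b c : N, (a * b) * c + (b * c) * a + (c * a) * b = 0) {M C : Submodule K N}
    (hM : IsIdeal M) (hC : IsIdeal C) {g : N} (hg : g * g ∈ C) :
    spanMul (C ⊔ K ∙ g) (spanMul (C ⊔ K ∙ g) M) ≤ spanMul C M := by
  have hCM := hC.spanMul hjac hM
  have hop (x : N) (P : Submodule K N) (hP : ∀ v ∈ M, ∀ b ∈ C ⊔ K ∙ g, x * (b * v) ∈ P) :
      ∀ y ∈ spanMul (C ⊔ K ∙ g) M, x * y ∈ P := by
    intro y hy
    have h : spanMul (C ⊔ K ∙ g) M ≤ P.comap (LinearMap.mulLeft K x) :=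
      spanMul_le.mpr fun b hb v hv => hP v hv b hb
    exact h hy
  refine spanMul_le.mpr fun a ha y hy => ?_
  revert y
  refine hop a _ fun v hv b hb => ?_
  obtain ⟨c, hc, _, hs, rfl⟩ := Submodule.mem_sup.mp ha
  obtain ⟨s, rfl⟩ := Submodule.mem_span_singleton.mp hs
  obtain ⟨d, hd, _, ht, rfl⟩ := Submodule.mem_sup.mp hb
  obtain ⟨t, rfl⟩ := Submodule.mem_span_singleton.mp ht
  have hgg : g * (g * v) ∈ spanMul C M := by
    have e : (2 : K) • (g * (g * v)) = -((g * g) * v) := by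
      have h := hjac g g v
      rw [mul_comm (g * v), mul_comm (v * g), mul_comm v g] at h
      rw [two_smul, eq_neg_iff_add_eq_zero, ← h]
      abel
    rw [← Submodule.smul_mem_iff _ h2, e]
    exact neg_mem (mul_mem_spanMul hg hv)
  rw [add_mul c, add_mul d (t • g) v, mul_add (s • g), smul_mul_assoc s, smul_mul_assoc s,
    smul_mul_assoc t, mul_smul_comm t]
  refine add_mem (mul_mem_spanMul hc (add_mem (hM d v hv) ?_))
    (add_mem (Submodule.smul_mem _ _ (hCM g _ (mul_mem_spanMul hd hv)))
      (Submodule.smul_mem _ _ (Submodule.smul_mem _ _ hgg)))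
  exact Submodule.smul_mem _ _ (hM g v hv)

theorem NilpotentOn.sup_span_singleton (h2 : (2 : K) ≠ 0)
    (hjac : ∀ a b c : N, (a * b) * c + (b * c) * a + (c * a) * b = 0) {I J C : Submodule K N}
    (hI : IsIdeal I) (hC : IsIdeal C) {g : N} (hgC : ∀ a, a * g ∈ C) (h : NilpotentOn I J C) :
    NilpotentOn I J (C ⊔ K ∙ g) := by
  obtain ⟨r, hr⟩ := h
  refine ⟨2 * r, le_trans ?_ hr⟩
  clear hr
  induction r with
  | zero => exact le_rfl
  | succ r ih =>
    rw [Nat.mul_succ, add_comm, Function.iterate_add_apply, Function.iterate_succ_apply' _ r]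
    refine (monotone_iterate_spanMul _ 2 ih).trans ?_
    exact spanMul_spanMul_sup_span_singleton_le h2 hjac (isIdeal_iterate_spanMul hjac hI hC r) hC
      (hgC g)

theorem NilpotentOn.sup_fg (h2 : (2 : K) ≠ 0)
    (hjac : ∀ a b c : N, (a * b) * c + (b * c) * a + (c * a) * b = 0) {I J : Submodule K N}
    (hI : IsIdeal I) {G : Submodule K N} (hG : G.FG) :
    ∀ C : Submodule K N, IsIdeal C → (∀ a : N, ∀ g ∈ G, a * g ∈ C) → NilpotentOn I J C →
      NilpotentOn I J (C ⊔ G) := by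
  induction G, hG using Submodule.fg_induction with
  | singleton g =>
    exact fun C hC hgC h =>
      h.sup_span_singleton h2 hjac hI hC fun a => hgC a g (Submodule.mem_span_singleton_self g)
  | sup G₁ G₂ _ _ ih₁ ih₂ =>
    intro C hC hgC h
    rw [← sup_assoc]
    refine ih₂ _ ?_ (fun a g hg => le_sup_left (a := C) (hgC a g (le_sup_right (a := G₁) hg)))
      (ih₁ C hC (fun a g hg => hgC a g (le_sup_left (a := G₁) hg)) h)
    intro a x hx
    obtain ⟨c, hc, g, hg, rfl⟩ := Submodule.mem_sup.mp hx
    rw [mul_add]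
    exact le_sup_left (a := C) (add_mem (hC a c hc) (hgC a g (le_sup_left (a := G₁) hg)))

theorem exists_lowerSeries_le_of_spanMul_self_le (h2 : (2 : K) ≠ 0)
    (hjac : ∀ a b c : N, (a * b) * c + (b * c) * a + (c * a) * b = 0) {F : Submodule K N}
    (hF : F.FG) (hFtop : F ⊔ spanMul ⊤ ⊤ = ⊤) {I J : Submodule K N} (hI : IsIdeal I)
    (hIJ : spanMul I I ≤ J) {k : ℕ} (hk : lowerSeries K N k ≤ I) :
    ∃ m, lowerSeries K N m ≤ J := by
  have hideal (j : ℕ) : IsIdeal (lowerSeries K N j) := by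
    intro a x hx
    exact lowerSeries_succ_le j (mul_mem_spanMul (I := ⊤) trivial hx)
  have hnil (i : ℕ) (hi : i ≤ k) : NilpotentOn I J (lowerSeries K N (k - i)) := by
    induction i with
    | zero => exact ⟨1, (Submodule.map₂_le_map₂_left hk).trans hIJ⟩
    | succ i ih =>
      obtain ⟨G, hG, he⟩ := exists_fg_sup_lowerSeries_succ hjac hF hFtop (k - (i + 1))
      rw [he, sup_comm, show k - (i + 1) + 1 = k - i by omega]
      refine (ih (by omega)).sup_fg h2 hjac hI hG _ (hideal _) fun a g hg => ?_
      rw [show k - i = k - (i + 1) + 1 by omega]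
      exact mul_mem_spanMul (I := ⊤) trivial (he ▸ le_sup_left (a := G) hg)
  obtain ⟨r, hr⟩ := hnil k le_rfl
  rw [Nat.sub_self] at hr
  have hadd (r : ℕ) : lowerSeries K N (k + r) ≤ (spanMul ⊤)^[r] I := by
    induction r with
    | zero => exact hk
    | succ r ih =>
      rw [Function.iterate_succ_apply']
      exact Submodule.map₂_le_map₂_right ih
  exact ⟨k + r, (hadd r).trans hr⟩

theorem exists_lowerSeries_eq_bot (h2 : (2 : K) ≠ 0) (h3 : (3 : K) ≠ 0)
    (hjac : ∀ a b c : N, (a * b) * c + (b * c) * a + (c * a) * b = 0) {F : Submodule K N}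
    (hF : F.FG) (hFtop : F ⊔ spanMul ⊤ ⊤ = ⊤) : ∃ m, lowerSeries K N m = ⊥ := by
  have hd (k : ℕ) : ∃ m, lowerSeries K N m ≤ derived K N k := by
    induction k with
    | zero => exact ⟨0, le_rfl⟩
    | succ k ih =>
      obtain ⟨m, hm⟩ := ih
      exact exists_lowerSeries_le_of_spanMul_self_le h2 hjac hF hFtop (derived_isIdeal hjac k)
        le_rfl hm
  obtain ⟨m, hm⟩ := hd 3
  refine ⟨m + 1, eq_bot_iff.mpr (spanMul_le.mpr fun a _ x hx => ?_)⟩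
  rw [mul_comm, derived_three_mul_eq_zero h2 h3 hjac (hm hx)]
  exact zero_mem _

theorem exists_fg_sup_spanMul_top_eq_top
    (hdcc : ∀ f : ℕ → Submodule K N, (∀ k, ∀ a : N, ∀ x ∈ f k, a * x ∈ f k) → Antitone f →
      ∃ n, ∀ m, n ≤ m → f m = f n) :
    ∃ F : Submodule K N, F.FG ∧ F ⊔ spanMul ⊤ ⊤ = ⊤ := by
  let D : Submodule K N := spanMul ⊤ ⊤
  have hart : IsArtinian K (N ⧸ D) := by
    rw [← monotone_stabilizes_iff_artinian]
    intro f
    obtain ⟨n, hn⟩ := hdcc (fun k => (OrderDual.ofDual (f k)).comap D.mkQ) (fun k a x _ => by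
      have h : a * x ∈ D := mul_mem_spanMul trivial trivial
      rw [Submodule.mem_comap, Submodule.mkQ_apply, (Submodule.Quotient.mk_eq_zero D).mpr h]
      exact zero_mem _) fun i j hij => Submodule.comap_mono (f.monotone hij)
    exact ⟨n, fun m hm => (Submodule.comap_injective_of_surjective D.mkQ_surjective (hn m hm)).symm⟩
  have hfin : Module.Finite K (N ⧸ D) := IsSemiprimaryRing.finite_of_isArtinian K K (N ⧸ D)
  obtain ⟨F, hF⟩ := D.exists_isCompl
  have : Module.Finite K F := Module.Finite.equiv (D.quotientEquivOfIsCompl F hF)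
  exact ⟨F, Module.Finite.iff_fg.mp this, by rw [sup_comm]; exact hF.sup_eq_top⟩

end Algebra

end MockLie

/-- Let `N` be a commutative (not necessarily associative) algebra over a field
`K` of characteristic `≠ 2, 3` satisfying the identity `x³ = 0` (where `x³ = x²·x`).  If `N`
satisfies the descending chain condition on ideals, then `N` is finite-dimensional over `K`. -/
theorem cube_zero_artinian_finiteDimensional {K N : Type*} [Field K]
    [NonUnitalNonAssocCommRing N] [Module K N] [SMulCommClass K N N] [IsScalarTower K N N]
    (h2 : (2 : K) ≠ 0) (h3 : (3 : K) ≠ 0)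
    (hcube : ∀ x : N, (x * x) * x = 0)
    -- d.c.c. on ideals of `N`
    (hacc : ∀ f : ℕ → Submodule K N, (∀ k, ∀ a : N, ∀ x ∈ f k, a * x ∈ f k) → Antitone f →
      ∃ n, ∀ m, n ≤ m → f m = f n) :
    FiniteDimensional K N := by
  have hjac := MockLie.jacobi_of_cube_eq_zero h2 hcube
  obtain ⟨F, hF, hFtop⟩ := MockLie.exists_fg_sup_spanMul_top_eq_top hacc
  obtain ⟨m, hm⟩ := MockLie.exists_lowerSeries_eq_bot h2 h3 hjac hF hFtop
  have hsup (k : ℕ) : ∃ H : Submodule K N, H.FG ∧ ⊤ = H ⊔ MockLie.lowerSeries K N k := by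
    induction k with
    | zero => exact ⟨⊥, Submodule.fg_bot, by simp [MockLie.lowerSeries]⟩
    | succ k ih =>
      obtain ⟨H, hH, hk⟩ := ih
      obtain ⟨G, hG, he⟩ := MockLie.exists_fg_sup_lowerSeries_succ hjac hF hFtop k
      exact ⟨H ⊔ G, hH.sup hG, by rw [sup_assoc, ← he, ← hk]⟩
  obtain ⟨H, hH, htop⟩ := hsup m
  rw [hm, sup_bot_eq] at htop
  exact ⟨htop ▸ hH⟩
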